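/- For every real number x, one has x·tanh(x) = (1/2) ∑_{k∈ℤ} ( 2 − i(2k−1)π/(2x + i(2k−1)π) + i(2k−1)π/(2x − i(2k−1)π) ), where the k-th summand is a complex number, each summand is in fact real, and the series over k∈ℤ converges. -/

import Mathlib

open Real Complex

/-- Mittag-Leffler expansion of `x * coth x - 1` for real `x ≠ 0`. -/
lemma hasSum_mul_coth_sub_one {x : ℝ} (hx : x ≠ 0) :
    HasSum (fun n : ℕ => 2 * x ^ 2 / (x ^ 2 + ((n : ℝ) + 1) ^ 2 * π ^ 2))
      (x * (Real.cosh x / Real.sinh x) - 1) := by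
  have hπ : (π : ℂ) ≠ 0 := by exact_mod_cast Real.pi_ne_zero
  have hxc : (x : ℂ) ≠ 0 := by exact_mod_cast hx
  have hz : ((x / π : ℝ) : ℂ) * Complex.I ∈ integerComplement := by
    rintro ⟨m, hm⟩
    have him := congrArg Complex.im hm
    simp only [Complex.intCast_im, Complex.im_ofReal_mul, Complex.I_im, mul_one] at him
    exact div_ne_zero hx Real.pi_ne_zero him.symm
  have hsum := (summable_cotTerm hz).hasSum
  rw [← cot_series_rep' hz] at hsum
  have hmul := hsum.mul_left (((x / π : ℝ) : ℂ) * Complex.I)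
  rw [← Complex.hasSum_ofReal]
  convert! hmul using 1
  · funext n
    have hden : ((x : ℂ) ^ 2 + ((n : ℂ) + 1) ^ 2 * (π : ℂ) ^ 2) ≠ 0 := by
      have h : x ^ 2 + ((n : ℝ) + 1) ^ 2 * π ^ 2 ≠ 0 := by positivity
      exact_mod_cast h
    rw [cotTerm_identity hz n]
    have hprod : (((x / π : ℝ) : ℂ) * Complex.I + (n + 1)) *
        (((x / π : ℝ) : ℂ) * Complex.I - (n + 1)) =
        -((x : ℂ) ^ 2 + ((n : ℂ) + 1) ^ 2 * (π : ℂ) ^ 2) / (π : ℂ) ^ 2 := by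
      push_cast
      field_simp
      linear_combination (x : ℂ) ^ 2 * Complex.I_sq
    rw [hprod]
    push_cast
    field_simp
    linear_combination Complex.I_sq
  · have harg : (π : ℂ) * (((x / π : ℝ) : ℂ) * Complex.I) = x * Complex.I := by
      push_cast
      field_simp
    have hsinh : Complex.sinh x ≠ 0 := by
      rw [← Complex.ofReal_sinh]
      exact_mod_cast Real.sinh_ne_zero.mpr hx
    rw [harg, Complex.cot, Complex.cos_mul_I, Complex.sin_mul_I]
    push_cast
    field_simp [Complex.I_ne_zero]

/-- Expansion of `x * tanh x` over the positive odd integers. -/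
lemma hasSum_mul_tanh_nat (x : ℝ) :
    HasSum (fun n : ℕ => 8 * x ^ 2 / (4 * x ^ 2 + (2 * (n : ℝ) + 1) ^ 2 * π ^ 2))
      (x * Real.tanh x) := by
  rcases eq_or_ne x 0 with rfl | hx
  · simp [hasSum_zero]
  set g : ℕ → ℝ := fun n => 2 * (2 * x) ^ 2 / ((2 * x) ^ 2 + ((n : ℝ) + 1) ^ 2 * π ^ 2) with hg
  have hall : HasSum g (2 * x * (Real.cosh (2 * x) / Real.sinh (2 * x)) - 1) :=
    hasSum_mul_coth_sub_one (mul_ne_zero two_ne_zero hx)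
  have hodd : HasSum (fun n => g (2 * n + 1)) (x * (Real.cosh x / Real.sinh x) - 1) := by
    convert hasSum_mul_coth_sub_one hx using 2 with n
    simp only [hg]
    push_cast
    rw [div_eq_div_iff (by positivity) (by positivity)]
    ring
  have heven : Summable fun n => g (2 * n) :=
    hall.summable.comp_injective (mul_right_injective₀ two_ne_zero)
  have hval : ∑' n, g (2 * n) = x * Real.tanh x := by
    have hsplit := (heven.hasSum.even_add_odd hodd).unique hall
    have hsinh : Real.sinh x ≠ 0 := Real.sinh_ne_zero.mpr hx
    have hcosh : Real.cosh x ≠ 0 := (Real.cosh_pos x).ne'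
    rw [eq_sub_of_add_eq hsplit, Real.sinh_two_mul, Real.cosh_two_mul, Real.tanh_eq_sinh_div_cosh]
    field_simp
    ring
  rw [← hval]
  convert heven.hasSum using 2 with n
  simp only [hg]
  push_cast
  ring

/-- Expansion of `x * tanh x` over all odd integers. -/
lemma hasSum_two_mul_tanh_int (x : ℝ) :
    HasSum (fun k : ℤ => 8 * x ^ 2 / (4 * x ^ 2 + (2 * (k : ℝ) - 1) ^ 2 * π ^ 2))
      (2 * (x * Real.tanh x)) := by
  have hnat := hasSum_mul_tanh_nat x
  have hshift : HasSum (fun k : ℤ => 8 * x ^ 2 / (4 * x ^ 2 + (2 * (k : ℝ) + 1) ^ 2 * π ^ 2))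
      (2 * (x * Real.tanh x)) := by
    rw [two_mul (x * Real.tanh x)]
    refine HasSum.of_nat_of_neg_add_one (by simpa using hnat) ?_
    convert hnat using 2 with n
    push_cast
    ring
  rw [← (Equiv.neg ℤ).hasSum_iff]
  convert hshift using 2 with k
  simp only [Function.comp_apply, Equiv.neg_apply]
  push_cast
  ring

lemma tanh_summand_eq_ofReal (x : ℝ) (k : ℤ) :
    (2 : ℂ)
        - (Complex.I * (2 * (k : ℂ) - 1) * (π : ℂ)) /
          (2 * (x : ℂ) + Complex.I * (2 * (k : ℂ) - 1) * (π : ℂ))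
        + (Complex.I * (2 * (k : ℂ) - 1) * (π : ℂ)) /
          (2 * (x : ℂ) - Complex.I * (2 * (k : ℂ) - 1) * (π : ℂ)) =
      ((8 * x ^ 2 / (4 * x ^ 2 + (2 * (k : ℝ) - 1) ^ 2 * π ^ 2) : ℝ) : ℂ) := by
  have hk : (2 * (k : ℝ) - 1) ≠ 0 := by
    have h : (2 * k - 1 : ℤ) ≠ 0 := by omega
    exact_mod_cast h
  have hden : (4 * (x : ℂ) ^ 2 + (2 * (k : ℂ) - 1) ^ 2 * (π : ℂ) ^ 2) ≠ 0 := by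
    have h : 4 * x ^ 2 + (2 * (k : ℝ) - 1) ^ 2 * π ^ 2 ≠ 0 := by positivity
    exact_mod_cast h
  have hfactor : (2 * (x : ℂ) + Complex.I * (2 * (k : ℂ) - 1) * (π : ℂ)) *
      (2 * (x : ℂ) - Complex.I * (2 * (k : ℂ) - 1) * (π : ℂ)) =
      4 * (x : ℂ) ^ 2 + (2 * (k : ℂ) - 1) ^ 2 * (π : ℂ) ^ 2 := by
    linear_combination (-((2 * (k : ℂ) - 1) ^ 2 * (π : ℂ) ^ 2)) * Complex.I_sq
  rw [← hfactor] at hden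
  have hadd := left_ne_zero_of_mul hden
  have hsub := right_ne_zero_of_mul hden
  push_cast
  rw [← hfactor]
  generalize Complex.I * (2 * (k : ℂ) - 1) * (π : ℂ) = a at hadd hsub
  field_simp
  ring

/-- Partial-fraction form of the Mittag-Leffler expansion of `x * tanh x`:
`x * tanh x = (1/2) ∑_{k ∈ ℤ} (2 - i(2k-1)π/(2x + i(2k-1)π) + i(2k-1)π/(2x - i(2k-1)π))`,
the (complex) summands being in fact real and the series over `k ∈ ℤ` converging. -/
theorem tanh_partial_fraction (x : ℝ) :
    (∀ k : ℤ, ((2 : ℂ)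
        - (Complex.I * (2 * (k : ℂ) - 1) * (π : ℂ)) / (2 * (x : ℂ) + Complex.I * (2 * (k : ℂ) - 1) * (π : ℂ))
        + (Complex.I * (2 * (k : ℂ) - 1) * (π : ℂ)) / (2 * (x : ℂ) - Complex.I * (2 * (k : ℂ) - 1) * (π : ℂ))).im
        = 0) ∧
    Summable (fun k : ℤ => (2 : ℂ)
        - (Complex.I * (2 * (k : ℂ) - 1) * (π : ℂ)) / (2 * (x : ℂ) + Complex.I * (2 * (k : ℂ) - 1) * (π : ℂ))
        + (Complex.I * (2 * (k : ℂ) - 1) * (π : ℂ)) / (2 * (x : ℂ) - Complex.I * (2 * (k : ℂ) - 1) * (π : ℂ))) ∧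
    (x * Real.tanh x : ℂ) = (1 / 2) * ∑' k : ℤ, ((2 : ℂ)
        - (Complex.I * (2 * (k : ℂ) - 1) * (π : ℂ)) / (2 * (x : ℂ) + Complex.I * (2 * (k : ℂ) - 1) * (π : ℂ))
        + (Complex.I * (2 * (k : ℂ) - 1) * (π : ℂ)) / (2 * (x : ℂ) - Complex.I * (2 * (k : ℂ) - 1) * (π : ℂ))) := by
  simp only [tanh_summand_eq_ofReal]
  have hsum := Complex.hasSum_ofReal.mpr (hasSum_two_mul_tanh_int x)
  refine ⟨fun k => Complex.ofReal_im _, hsum.summable, ?_⟩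
  rw [hsum.tsum_eq]
  push_cast
  ring
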